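/- Let d ∈ ℕ and L > 0. Let X_n, X : ℝ × (ℝ^d) → ℝ^d be continuous maps such that ‖X_n(t, y)‖ ≤ L for all n, t, y, and such that X_n converges to X uniformly on [0,1] × ℝ^d. Let K ⊆ ℝ^d be a compact set, and let x_n : ℝ → ℝ^d be curves such that x_n(0) ∈ K for every n and, for every t ∈ [0,1], x_n has derivative X_n(t, x_n(t)) at t. Then there exist a strictly monotone increasing φ : ℕ → ℕ and a curve x_* : [0,1] → ℝ^d such that x_{φ(j)} converges to x_* uniformly on [0,1] and, for every t ∈ [0,1], x_* is differentiable at t (within [0,1]) with derivative X(t, x_*(t)). Moreover, if additionally x_n(1) = x_n(0) for every n, then x_*(1) = x_*(0). -/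

import Mathlib

open Filter Topology Set

/-- A sequence of curves with uniformly Lipschitz restrictions to `[0, 1]` starting in a compact
set has a subsequence converging uniformly on `[0, 1]`. -/
theorem exists_tendstoUniformlyOn_subseq_of_lipschitzOnWith {E : Type*} [NormedAddCommGroup E]
    [ProperSpace E] {C : NNReal} {x : ℕ → ℝ → E} {K : Set E} (hK : Bornology.IsBounded K)
    (hx0 : ∀ n, x n 0 ∈ K) (hx : ∀ n, LipschitzOnWith C (x n) (Icc 0 1)) :
    ∃ φ : ℕ → ℕ, StrictMono φ ∧ ∃ y : ℝ → E,
      TendstoUniformlyOn (fun j => x (φ j)) y atTop (Icc 0 1) := by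
  obtain ⟨R, hR⟩ := hK.exists_norm_le
  let f : ℕ → BoundedContinuousFunction (Icc (0 : ℝ) 1) E := fun n =>
    BoundedContinuousFunction.mkOfCompact ⟨(Icc 0 1).domRestrict (x n), (hx n).continuousOn.domRestrict⟩
  have hf : ∀ n s, f n s = x n s := fun n s => rfl
  have hcomp : IsCompact (closure (range f)) := by
    refine BoundedContinuousFunction.arzela_ascoli (Metric.closedBall (0 : E) (R + C))
      (isCompact_closedBall _ _) _ ?_ ?_
    · rintro _ s ⟨n, rfl⟩
      have h := (hx n).dist_le_mul s s.2 0 (by simp)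
      have h1 : ‖x n s‖ ≤ ‖x n 0‖ + ‖x n s - x n 0‖ := norm_le_norm_add_norm_sub' _ _
      rw [dist_eq_norm, Real.dist_eq, sub_zero, abs_of_nonneg s.2.1] at h
      have h2 : (C : ℝ) * s ≤ C := mul_le_of_le_one_right C.2 s.2.2
      rw [mem_closedBall_zero_iff, hf]
      linarith [hR _ (hx0 n)]
    · refine UniformEquicontinuous.equicontinuous
        (LipschitzWith.uniformEquicontinuous _ C ?_)
      rintro ⟨_, n, rfl⟩
      exact (hx n).to_restrict
  obtain ⟨g, -, φ, hφ, hg⟩ := hcomp.tendsto_subseq fun n =>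
    subset_closure (mem_range_self (f := f) n)
  refine ⟨φ, hφ, IccExtend zero_le_one g, ?_⟩
  rw [tendstoUniformlyOn_iff_tendstoUniformly_comp_coe]
  have hunif := BoundedContinuousFunction.tendsto_iff_tendstoUniformly.1 hg
  have hext : IccExtend (zero_le_one (α := ℝ)) g ∘ (↑) = g :=
    funext fun s => IccExtend_val _ _ s
  rw [hext]
  exact hunif

/-- If the derivatives of `f n` converge to `v` jointly as `n → ∞` and the point tends to `t`
within a convex set, then a pointwise limit of `f n` has derivative `v` at `t` within that set. -/
theorem hasDerivWithinAt_of_tendsto_prod {E ι : Type*} [NormedAddCommGroup E] [NormedSpace ℝ E]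
    {l : Filter ι} [l.NeBot] {S : Set ℝ} (hS : Convex ℝ S) {t : ℝ} (ht : t ∈ S)
    {f f' : ι → ℝ → E} {g : ℝ → E} {v : E}
    (hf : ∀ n, ∀ s ∈ S, HasDerivWithinAt (f n) (f' n s) S s)
    (hfg : ∀ s ∈ S, Tendsto (fun n => f n s) l (𝓝 (g s)))
    (hf' : Tendsto (fun p : ι × ℝ => f' p.1 p.2) (l ×ˢ 𝓝[S] t) (𝓝 v)) :
    HasDerivWithinAt g v S t := by
  rw [hasDerivWithinAt_iff_isLittleO, Asymptotics.isLittleO_iff]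
  intro ε hε
  obtain ⟨P, hP, Q, hQ, hPQ⟩ := eventually_prod_iff.1 (Metric.tendsto_nhds.1 hf' ε hε)
  obtain ⟨δ, hδ, hball⟩ := Metric.mem_nhdsWithin_iff.1 hQ
  filter_upwards [inter_mem_nhdsWithin S (Metric.ball_mem_nhds t hδ)] with s hs
  have hlim : Tendsto (fun n => ‖f n s - f n t - (s - t) • v‖) l
      (𝓝 ‖g s - g t - (s - t) • v‖) :=
    (((hfg s hs.1).sub (hfg t ht)).sub_const _).norm
  refine le_of_tendsto hlim (hP.mono fun n hn => ?_)
  have hmv := (hS.inter (convex_ball t δ)).norm_image_sub_le_of_norm_hasDerivWithin_le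
    (f := fun r => f n r - r • v) (f' := fun r => f' n r - (1 : ℝ) • v) (C := ε)
    (fun r hr => (((hf n r hr.1).mono inter_subset_left).sub
      ((hasDerivWithinAt_id r _).smul_const v)))
    (fun r hr => by
      rw [one_smul, ← dist_eq_norm]
      exact (hPQ hn (hball ⟨hr.2, hr.1⟩)).le)
    ⟨ht, Metric.mem_ball_self hδ⟩ hs
  rwa [sub_smul, sub_sub_sub_comm]


/-- Analytic core of Lemma 3.1: uniformly bounded time-dependent vector fields
`Xn` on `ℝ^d` converging uniformly to `X`, together with solutions `xn` of the
corresponding ODEs with initial values in a compact set, admit a subsequence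
converging uniformly on `[0,1]` to a solution `x⋆` of the limiting ODE; if all
`xn` are 1-periodic, so is `x⋆`. -/
theorem subsequence_converges_to_solution
    (d : ℕ) (L : ℝ) (hL : 0 < L)
    (Xn : ℕ → ℝ × EuclideanSpace ℝ (Fin d) → EuclideanSpace ℝ (Fin d))
    (X : ℝ × EuclideanSpace ℝ (Fin d) → EuclideanSpace ℝ (Fin d))
    (hXn_cont : ∀ n, Continuous (Xn n)) (hX_cont : Continuous X)
    (hbound : ∀ n t y, ‖Xn n (t, y)‖ ≤ L)
    (hXconv : TendstoUniformlyOn Xn X Filter.atTop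
      (Set.Icc (0:ℝ) 1 ×ˢ (Set.univ : Set (EuclideanSpace ℝ (Fin d)))))
    (K : Set (EuclideanSpace ℝ (Fin d))) (hK : IsCompact K)
    (xn : ℕ → ℝ → EuclideanSpace ℝ (Fin d))
    (hinit : ∀ n, xn n 0 ∈ K)
    (hsol : ∀ n, ∀ t ∈ Set.Icc (0:ℝ) 1, HasDerivAt (xn n) (Xn n (t, xn n t)) t) :
    ∃ φ : ℕ → ℕ, StrictMono φ ∧ ∃ xs : ℝ → EuclideanSpace ℝ (Fin d),
      TendstoUniformlyOn (fun j => xn (φ j)) xs Filter.atTop (Set.Icc (0:ℝ) 1) ∧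
      (∀ t ∈ Set.Icc (0:ℝ) 1,
        HasDerivWithinAt xs (X (t, xs t)) (Set.Icc (0:ℝ) 1) t) ∧
      ((∀ n, xn n 1 = xn n 0) → xs 1 = xs 0) := by
  have hderiv : ∀ n, ∀ t ∈ Icc (0 : ℝ) 1,
      HasDerivWithinAt (xn n) (Xn n (t, xn n t)) (Icc 0 1) t :=
    fun n t ht => (hsol n t ht).hasDerivWithinAt
  have hlip : ∀ n, LipschitzOnWith L.toNNReal (xn n) (Icc 0 1) := fun n =>
    (convex_Icc (0 : ℝ) 1).lipschitzOnWith_of_nnnorm_hasDerivWithin_le (hderiv n) fun t _ => by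
      rw [← NNReal.coe_le_coe, coe_nnnorm, Real.coe_toNNReal _ hL.le]
      exact hbound n t _
  obtain ⟨φ, hφ, xs, hxs⟩ :=
    exists_tendstoUniformlyOn_subseq_of_lipschitzOnWith hK.isBounded hinit hlip
  refine ⟨φ, hφ, xs, hxs, fun t ht => ?_, fun hper => ?_⟩
  · refine hasDerivWithinAt_of_tendsto_prod (convex_Icc 0 1) ht (fun j => hderiv (φ j))
      (fun s hs => hxs.tendsto_at hs) ?_
    have hxs_cont : ContinuousOn xs (Icc 0 1) :=
      hxs.continuousOn (Frequently.of_forall fun j => (hlip (φ j)).continuousOn)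
    have hIcc : ∀ᶠ p : ℕ × ℝ in atTop ×ˢ 𝓝[Icc 0 1] t, p.2 ∈ Icc (0 : ℝ) 1 :=
      tendsto_snd.eventually self_mem_nhdsWithin
    have hcurve : Tendsto (fun p : ℕ × ℝ => xn (φ p.1) p.2) (atTop ×ˢ 𝓝[Icc 0 1] t)
        (𝓝 (xs t)) := by
      refine ((hxs_cont t ht).tendsto.comp tendsto_snd).congr_dist ?_
      refine Metric.tendsto_nhds.2 fun ε hε => ?_
      filter_upwards [hIcc, tendsto_fst.eventually (Metric.tendstoUniformlyOn_iff.1 hxs ε hε)]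
        with p hp hpε
      simpa using hpε p.2 hp
    have htime : Tendsto (fun p : ℕ × ℝ => p.2) (atTop ×ˢ 𝓝[Icc 0 1] t) (𝓝 t) :=
      tendsto_snd.mono_right nhdsWithin_le_nhds
    refine ((hX_cont.tendsto (t, xs t)).comp (htime.prodMk_nhds hcurve)).congr_dist ?_
    refine Metric.tendsto_nhds.2 fun ε hε => ?_
    filter_upwards [hIcc, (hφ.tendsto_atTop.comp tendsto_fst).eventually
      (Metric.tendstoUniformlyOn_iff.1 hXconv ε hε)] with p hp hpε
    simpa using hpε (p.2, xn (φ p.1) p.2) ⟨hp, mem_univ _⟩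
  · refine tendsto_nhds_unique (hxs.tendsto_at (right_mem_Icc.2 zero_le_one)) ?_
    simpa only [hper] using hxs.tendsto_at (left_mem_Icc.2 zero_le_one)
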